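/- (Wirthmüller isomorphism.) Let f* : D → C be a coproduct-preserving tensor-exact functor between rigidly-compactly generated tensor-triangulated categories satisfying Grothendieck-Neeman duality, so that there are five adjoints f_(1) ⊣ f* ⊣ f_* ⊣ f^(1) ⊣ f_(-1), and let ω := f^(1)(𝟙). Then the following are equivalent: (W1) f_(1) admits a left adjoint, equivalently f_(1) preserves arbitrary products; (W2) f_(-1) admits a right adjoint, equivalently f_(-1) preserves arbitrary coproducts, equivalently f^(1) preserves compact objects; (W3) ω is a compact object of C; (W4) ω is ⊗-invertible in C; (W5) there exists a ⊗-invertible object u ∈ C such that f_*(u ⊗ −) is left adjoint to f*; (W6) there exists a doubly infinite tower of adjoints ⋯ ⊣ f^(n) ⊣ f_(-n) ⊣ f^(n+1) ⊣ ⋯ extending f* = f^(0) and f_* = f_(0). Moreover, when these conditions hold, the tower of adjoints is necessarily given for all n ∈ ℤ by f^(n) = ω^{⊗n} ⊗ f*(−) and f_(n) = f_*(ω^{⊗n} ⊗ −). -/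

import Mathlib

/-!
Formalization of statements from "Grothendieck-Neeman duality and the
Wirthmüller isomorphism" by Balmer, Dell'Ambrogio and Sanders.
-/

noncomputable section

open CategoryTheory CategoryTheory.Limits CategoryTheory.Pretriangulated
  CategoryTheory.MonoidalCategory CategoryTheory.MonoidalClosed Opposite

universe v u u₁ u₂ u₃

namespace GN

section Compact

variable {C : Type u} [Category.{v} C]

/-- An object `t` is compact if `Hom(t, -)`, viewed as a functor to abelian groups,
preserves small coproducts. -/
def IsCompactObj [Preadditive C] (t : C) : Prop :=
  ∀ J : Type v, Nonempty (PreservesColimitsOfShape (Discrete J)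
    (preadditiveCoyoneda.obj (op t)))

/-- A functor preserves arbitrary (small) coproducts. -/
def PreservesCoproducts {D : Type u₂} [Category.{v} D] (F : C ⥤ D) : Prop :=
  ∀ J : Type v, Nonempty (PreservesColimitsOfShape (Discrete J) F)

/-- A functor preserves arbitrary (small) products. -/
def PreservesProducts {D : Type u₂} [Category.{v} D] (F : C ⥤ D) : Prop :=
  ∀ J : Type v, Nonempty (PreservesLimitsOfShape (Discrete J) F)

/-- A compactly generated category: it admits all small coproducts and
has a set of compact generators. -/
structure CompactlyGenerated (C : Type u) [Category.{v} C] [Preadditive C] : Prop where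
  hasCoproducts : HasCoproducts.{v} C
  exists_generators : ∃ (ι : Type v) (G : ι → C), (∀ i, IsCompactObj (G i)) ∧
    ∀ t : C, (∀ (i : ι) (f : G i ⟶ t), f = 0) → IsZero t

end Compact

section Tensor

variable {C : Type u} [Category.{v} C] [MonoidalCategory C] [MonoidalClosed C]

/-- The canonical map `hom(x,𝟙) ⊗ y ⟶ hom(x,y)`. -/
def rigidComparison (x y : C) : (ihom x).obj (𝟙_ C) ⊗ y ⟶ (ihom x).obj y :=
  MonoidalClosed.curry ((α_ x ((ihom x).obj (𝟙_ C)) y).inv ≫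
    (((ihom.ev x).app (𝟙_ C)) ▷ y) ≫ (λ_ y).hom)

/-- An object `x` is rigid if `hom(x,𝟙) ⊗ y ⟶ hom(x,y)` is an isomorphism for all `y`. -/
def IsRigid (x : C) : Prop := ∀ y : C, IsIso (rigidComparison x y)

/-- An object `u` is `⊗`-invertible if `u ⊗ v ≅ 𝟙` for some `v`. -/
def TensorInvertible (u : C) : Prop := ∃ v : C, Nonempty (u ⊗ v ≅ 𝟙_ C)

/-- The `κ`-twisted duality functor `D_κ = hom(-,κ)`. -/
@[reducible] def Dfun (κ : C) : Cᵒᵖ ⥤ C := MonoidalClosed.internalHom.flip.obj κ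

/-- The canonical double-duality map `ϖ : x ⟶ D_κ D_κ (x)`, i.e. the unit/counit of the
self-adjunction of `D_κ = hom(-,κ)`. -/
def varpi [BraidedCategory C] (κ x : C) : x ⟶ (ihom ((ihom x).obj κ)).obj κ :=
  MonoidalClosed.curry ((β_ ((ihom x).obj κ) x).hom ≫ (ihom.ev x).app κ)

/-- A rigidly-compactly generated tensor-triangulated category: it admits all small
coproducts, its compact objects coincide with its rigid objects, and it has a set of
compact generators. -/
structure RigidlyCompactlyGenerated (C : Type u) [Category.{v} C] [Preadditive C]
    [MonoidalCategory C] [MonoidalClosed C] : Prop where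
  hasCoproducts : HasCoproducts.{v} C
  compact_iff_rigid : ∀ x : C, IsCompactObj x ↔ IsRigid x
  exists_generators : ∃ (ι : Type v) (G : ι → C), (∀ i, IsCompactObj (G i)) ∧
    ∀ t : C, (∀ (i : ι) (f : G i ⟶ t), f = 0) → IsZero t

end Tensor

section Triang

variable {C : Type u} [Category.{v} C] [HasZeroObject C] [Preadditive C] [HasShift C ℤ]
  [∀ n : ℤ, (shiftFunctor C n).Additive] [Pretriangulated C]

/-- A thick triangulated subcategory, given as a predicate on objects:
it contains the zero objects, and is closed under shifts, cones and direct summands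
(hence in particular under isomorphisms). -/
structure IsThickSubcategory (S : Set C) : Prop where
  zero : ∀ x : C, IsZero x → x ∈ S
  shift : ∀ x ∈ S, ∀ n : ℤ, x⟦n⟧ ∈ S
  ext₃ : ∀ T : Triangle C, (T ∈ distTriang C) → T.obj₁ ∈ S → T.obj₂ ∈ S → T.obj₃ ∈ S
  retract : ∀ x y : C, (∃ (s : x ⟶ y) (r : y ⟶ x), s ≫ r = 𝟙 x) → y ∈ S → x ∈ S

/-- The thick subcategory generated by a set of objects. -/
def thickClosure (S : Set C) : Set C :=
  { x | ∀ T : Set C, IsThickSubcategory T → S ⊆ T → x ∈ T }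

/-- A `C^c`-submodule of `C`: a thick triangulated subcategory which is closed under
tensoring with compact objects. -/
structure IsSubmodule [MonoidalCategory C] (S : Set C) extends IsThickSubcategory S : Prop where
  smul : ∀ c x : C, IsCompactObj c → x ∈ S → (c ⊗ x) ∈ S

end Triang

section Dual

variable {C : Type u} [Category.{v} C] [MonoidalCategory C] [BraidedCategory C]
  [MonoidalClosed C]

/-- `κ` is a (possibly external) dualizing object for `S ⊆ C`: the `κ`-twisted
duality `D_κ = hom(-,κ)` preserves `S` and every object of `S` is `κ`-reflexive;
equivalently, `D_κ` restricts to an anti-equivalence `S^op ≃ S`. -/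
structure IsExternalDualizing (S : Set C) (κ : C) : Prop where
  stable : ∀ x ∈ S, (ihom x).obj κ ∈ S
  reflexive : ∀ x ∈ S, IsIso (varpi κ x)

/-- `κ ∈ S` is a dualizing object for `S`. -/
structure IsDualizing (S : Set C) (κ : C) extends IsExternalDualizing S κ : Prop where
  mem : κ ∈ S

end Dual

section Pullback

variable {C : Type u₁} {D : Type u₂} [Category.{v} C] [Category.{v} D]
  [Preadditive C] [MonoidalCategory C]

/-- The compact pull-back `f^#(D₀)` of a subcategory `D₀ ⊆ D` along `f_* : C ⥤ D`. -/
def compactPullback (fpush : C ⥤ D) (D₀ : Set D) : Set C :=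
  { x | ∀ c : C, IsCompactObj c → fpush.obj (c ⊗ x) ∈ D₀ }

end Pullback

section Proj

variable {D : Type u₁} {C : Type u₂} [Category.{v} D] [Category.{v} C]
  [MonoidalCategory D] [MonoidalCategory C]

/-- The canonical projection formula map `π : x ⊗ f_*(y) ⟶ f_*(f^*(x) ⊗ y)`,
obtained by adjunction from `f^*(x ⊗ f_* y) ≅ f^* x ⊗ f^* f_* y → f^* x ⊗ y`. -/
def projFormula (fstar : D ⥤ C) [fstar.Monoidal] (fpush : C ⥤ D) (adj : fstar ⊣ fpush)
    (x : D) (y : C) : x ⊗ fpush.obj y ⟶ fpush.obj (fstar.obj x ⊗ y) :=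
  (adj.homEquiv _ _)
    (Functor.OplaxMonoidal.δ fstar x (fpush.obj y) ≫ (fstar.obj x ◁ adj.counit.app y))

/-- The canonical comparison map `f^(1)(x) ⊗ f^*(y) ⟶ f^(1)(x ⊗ y)`, obtained by
adjunction from the counit `f_* f^(1) → Id` via the projection formula. -/
def gnComparison [BraidedCategory D] [BraidedCategory C] (fstar : D ⥤ C) [fstar.Monoidal]
    (fpush : C ⥤ D) (adj1 : fstar ⊣ fpush) (fone : D ⥤ C) (adj2 : fpush ⊣ fone)
    (hπ : ∀ (x : D) (y : C), IsIso (projFormula fstar fpush adj1 x y)) (x y : D) :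
    fone.obj x ⊗ fstar.obj y ⟶ fone.obj (x ⊗ y) :=
  haveI := hπ y (fone.obj x)
  (adj2.homEquiv _ _)
    (fpush.map (β_ (fone.obj x) (fstar.obj y)).hom ≫
      inv (projFormula fstar fpush adj1 y (fone.obj x)) ≫
      (β_ y (fpush.obj (fone.obj x))).hom ≫ (adj2.counit.app x ▷ y))

end Proj

section CompactObjects

lemma additive_of_adjunction {A : Type u₁} {B : Type u₂} [Category.{v} A] [Category.{v} B]
    [Preadditive A] [Preadditive B] [HasBinaryBiproducts A]
    {L : B ⥤ A} {R : A ⥤ B} (adj : L ⊣ R) : R.Additive := by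
  have : PreservesLimitsOfSize.{0, 0} R := adj.rightAdjoint_preservesLimits
  have := adj.isRightAdjoint
  exact R.additive_of_preserves_binary_products

lemma preservesCoproducts_of_adjunction {A : Type u₁} {B : Type u₂} [Category.{v} A]
    [Category.{v} B] {L : A ⥤ B} {R : B ⥤ A} (adj : L ⊣ R) : PreservesCoproducts L := fun _ =>
  ⟨have := adj.leftAdjoint_preservesColimits; inferInstance⟩

/-- A left adjoint preserves compact objects as soon as its right adjoint preserves coproducts. -/
lemma IsCompactObj.map {A : Type u₁} {B : Type u₂} [Category.{v} A] [Category.{v} B]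
    [Preadditive A] [Preadditive B] [HasBinaryBiproducts A]
    {L : B ⥤ A} {R : A ⥤ B} (adj : L ⊣ R) (hR : PreservesCoproducts R)
    {c : B} (hc : IsCompactObj c) : IsCompactObj (L.obj c) := by
  have := additive_of_adjunction adj
  intro J
  obtain ⟨_⟩ := hR J
  obtain ⟨_⟩ := hc J
  have hadd (X : A) (f g : c ⟶ R.obj X) : (adj.homEquiv c X).symm (f + g) =
      (adj.homEquiv c X).symm f + (adj.homEquiv c X).symm g := by
    apply (adj.homEquiv c X).injective
    rw [Adjunction.homEquiv_unit _ _ _ (_ + _), R.map_add, Preadditive.comp_add,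
      ← Adjunction.homEquiv_unit, ← Adjunction.homEquiv_unit]
    simp only [Equiv.apply_symm_apply]
  let e : R ⋙ preadditiveCoyoneda.obj (op c) ≅ preadditiveCoyoneda.obj (op (L.obj c)) :=
    NatIso.ofComponents (fun X => AddEquiv.toAddCommGrpIso
      { (adj.homEquiv c X).symm with map_add' := hadd X })
      (fun f => by
        ext g
        exact adj.homEquiv_naturality_right_symm g f)
  exact ⟨preservesColimitsOfShape_of_natIso e⟩

lemma IsCompactObj.of_iso {A : Type u₁} [Category.{v} A] [Preadditive A] {c c' : A} (e : c ≅ c')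
    (hc : IsCompactObj c) : IsCompactObj c' := fun J => by
  obtain ⟨_⟩ := hc J
  exact ⟨preservesColimitsOfShape_of_natIso (preadditiveCoyoneda.mapIso e.op.symm)⟩

end CompactObjects

section Detection

/-- There is a set of compact objects detecting the zero objects. -/
def HasCompactGenerators (A : Type u₁) [Category.{v} A] [Preadditive A] : Prop :=
  ∃ (ι : Type v) (G : ι → A), (∀ i, IsCompactObj (G i)) ∧
    ∀ t : A, (∀ (i : ι) (f : G i ⟶ t), f = 0) → IsZero t

variable {A : Type u₁} [Category.{v} A] [HasZeroObject A] [Preadditive A] [HasShift A ℤ]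
  [∀ n : ℤ, (shiftFunctor A n).Additive] [Pretriangulated A]

lemma IsCompactObj.shift {c : A} (hc : IsCompactObj c) (n : ℤ) : IsCompactObj (c⟦n⟧) :=
  hc.map (shiftEquiv A n).toAdjunction
    (preservesCoproducts_of_adjunction (shiftEquiv A n).symm.toAdjunction)

lemma isIso_of_bijective_compact (hA : HasCompactGenerators A) {a b : A} (φ : a ⟶ b)
    (h : ∀ c : A, IsCompactObj c → Function.Bijective (fun g : c ⟶ a => g ≫ φ)) : IsIso φ := by
  obtain ⟨ι, G, hG, hz⟩ := hA
  obtain ⟨Z, g, k, hT⟩ := distinguished_cocone_triangle φ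
  refine (Triangle.isZero₃_iff_isIso₁ _ hT).1 (hz _ fun i f => ?_)
  have h₁₂ : φ ≫ g = 0 := comp_distTriang_mor_zero₁₂ _ hT
  have h₃₁ : k ≫ φ⟦(1 : ℤ)⟧' = 0 := comp_distTriang_mor_zero₃₁ _ hT
  change G i ⟶ Z at f
  change f = 0
  let adj : shiftFunctor A (-1 : ℤ) ⊣ shiftFunctor A (1 : ℤ) :=
    (shiftEquiv' A (-1 : ℤ) 1 (by simp)).toAdjunction
  have hk : f ≫ k = 0 := by
    apply (adj.homEquiv _ _).symm.injective
    apply (h _ ((hG i).shift (-1))).1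
    dsimp only
    rw [← adj.homEquiv_naturality_right_symm, Category.assoc, h₃₁, comp_zero,
      Adjunction.homEquiv_counit, Adjunction.homEquiv_counit]
    simp
  obtain ⟨l, hl⟩ : ∃ l : G i ⟶ b, f = l ≫ g := Triangle.coyoneda_exact₃ _ hT f hk
  obtain ⟨m, hm⟩ := (h _ (hG i)).2 l
  dsimp only at hm
  rw [hl, ← hm, Category.assoc, h₁₂, comp_zero]

/-- A natural transformation between left adjoint functors out of a compactly generated
triangulated category is invertible as soon as it is so on compact objects. -/
lemma isIso_of_isIso_compact (hA : HasCompactGenerators A) {B : Type u₂} [Category.{v} B]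
    {L₁ L₂ : A ⥤ B} {R₁ R₂ : B ⥤ A} (adj₁ : L₁ ⊣ R₁) (adj₂ : L₂ ⊣ R₂) (τ : L₁ ⟶ L₂)
    (h : ∀ c : A, IsCompactObj c → IsIso (τ.app c)) : IsIso τ := by
  have : IsIso (conjugateEquiv adj₂ adj₁ τ) := by
    rw [NatTrans.isIso_iff_isIso_app]
    intro b
    refine isIso_of_bijective_compact hA _ fun c hc => ?_
    have := h c hc
    have e : (fun g : c ⟶ R₂.obj b => g ≫ (conjugateEquiv adj₂ adj₁ τ).app b) =
        fun g => adj₁.homEquiv _ _ (τ.app c ≫ (adj₂.homEquiv _ _).symm g) := by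
      ext g
      obtain ⟨g, rfl⟩ := (adj₂.homEquiv _ _).surjective g
      rw [Equiv.symm_apply_apply, Adjunction.homEquiv_unit, Adjunction.homEquiv_unit,
        Category.assoc, NatTrans.naturality, reassoc_of% unit_conjugateEquiv, R₁.map_comp]
    rw [e]
    exact (adj₁.homEquiv _ _).bijective.comp
      (((asIso (τ.app c)).homFromEquiv).symm.bijective.comp (adj₂.homEquiv _ _).symm.bijective)
  exact conjugateEquiv_of_iso adj₂ adj₁ τ

end Detection

section Duality

variable {C : Type u} [Category.{v} C] [MonoidalCategory C]

lemma whiskerLeft_rigidComparison_ev [MonoidalClosed C] (x y : C) :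
    x ◁ rigidComparison x y ≫ (ihom.ev x).app y =
      (α_ x ((ihom x).obj (𝟙_ C)) y).inv ≫ (ihom.ev x).app (𝟙_ C) ▷ y ≫ (λ_ y).hom := by
  rw [← uncurry_eq]
  exact uncurry_curry _

lemma isRigid_unit [MonoidalClosed C] : IsRigid (𝟙_ C) := by
  have : (tensorLeft (𝟙_ C)).IsEquivalence :=
    Functor.isEquivalence_of_iso (leftUnitorNatIso C).symm
  have : (ihom (𝟙_ C)).IsEquivalence :=
    (ihom.adjunction (𝟙_ C)).isEquivalence_right_of_isEquivalence_left
  have hev (y : C) : IsIso ((ihom.ev (𝟙_ C)).app y) :=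
    inferInstanceAs (IsIso ((ihom.adjunction (𝟙_ C)).counit.app y))
  intro y
  have h := whiskerLeft_rigidComparison_ev (𝟙_ C) y
  have : IsIso (𝟙_ C ◁ rigidComparison (𝟙_ C) y) :=
    IsIso.of_isIso_fac_right h
  rw [id_whiskerLeft] at this
  have h' : IsIso (rigidComparison (𝟙_ C) y ≫ (λ_ _).inv) := IsIso.of_isIso_comp_left (λ_ _).hom _
  exact IsIso.of_isIso_comp_right _ (λ_ _).inv

lemma whiskerLeft_zigzag {x y : C} (η : 𝟙_ C ⟶ y ⊗ x) (ε : x ⊗ y ⟶ 𝟙_ C)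
    (zigzag : x ◁ η ≫ (α_ x y x).inv ≫ ε ▷ x = (ρ_ x).hom ≫ (λ_ x).inv) :
    x ◁ η ▷ y ≫ x ◁ (α_ y x y).hom ≫ x ◁ y ◁ ε ≫
      (α_ x y (𝟙_ C)).inv ≫ ε ▷ (𝟙_ C) ≫ (λ_ (𝟙_ C)).hom =
    x ◁ (λ_ y).hom ≫ x ◁ (ρ_ y).inv ≫ (α_ x y (𝟙_ C)).inv ≫ ε ▷ (𝟙_ C) ≫ (λ_ (𝟙_ C)).hom := by
  have e : x ◁ η ▷ y ≫ x ◁ (α_ y x y).hom ≫ x ◁ y ◁ ε ≫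
      (α_ x y (𝟙_ C)).inv ≫ ε ▷ (𝟙_ C) ≫ (λ_ (𝟙_ C)).hom =
    (α_ x (𝟙_ C) y).inv ≫ (x ◁ η ≫ (α_ x y x).inv ≫ ε ▷ x) ▷ y ≫
      (α_ (𝟙_ C) x y).hom ≫ 𝟙_ C ◁ ε ≫ (λ_ (𝟙_ C)).hom := by
    have : x ◁ y ◁ ε ≫ (α_ x y (𝟙_ C)).inv ≫ ε ▷ (𝟙_ C) =
        (α_ x y (x ⊗ y)).inv ≫ ε ▷ (x ⊗ y) ≫ 𝟙_ C ◁ ε := by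
      rw [← whisker_exchange]
      monoidal
    rw [reassoc_of% this]
    monoidal
  rw [e, zigzag]
  monoidal

/-- The evaluation pairing of a rigid object with its dual is exact. -/
lemma IsRigid.exactPairing [MonoidalClosed C] {x : C} (hx : IsRigid x) :
    Nonempty (ExactPairing ((ihom x).obj (𝟙_ C)) x) := by
  have := hx x
  have := hx (𝟙_ C)
  have h : x ◁ inv (rigidComparison x x) ≫ (α_ x ((ihom x).obj (𝟙_ C)) x).inv ≫
      (ihom.ev x).app (𝟙_ C) ▷ x = (ihom.ev x).app x ≫ (λ_ x).inv := by
    rw [← cancel_mono (λ_ x).hom, Category.assoc, Category.assoc, Category.assoc,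
      Iso.inv_hom_id, Category.comp_id, ← whiskerLeft_rigidComparison_ev,
      ← MonoidalCategory.whiskerLeft_comp_assoc, IsIso.inv_hom_id]
    simp
  have zigzag : x ◁ (curry (ρ_ x).hom ≫ inv (rigidComparison x x)) ≫
      (α_ x ((ihom x).obj (𝟙_ C)) x).inv ≫ (ihom.ev x).app (𝟙_ C) ▷ x =
        (ρ_ x).hom ≫ (λ_ x).inv := by
    rw [MonoidalCategory.whiskerLeft_comp, Category.assoc, h, ← Category.assoc,
      ← uncurry_eq, uncurry_curry]
  refine ⟨{ coevaluation' := curry (ρ_ x).hom ≫ inv (rigidComparison x x)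
            evaluation' := (ihom.ev x).app (𝟙_ C)
            coevaluation_evaluation' := zigzag
            evaluation_coevaluation' := ?_ }⟩
  generalize curry (ρ_ x).hom ≫ inv (rigidComparison x x) = η at zigzag
  rw [← cancel_mono (rigidComparison x (𝟙_ C))]
  apply uncurry_injective
  simp only [uncurry_eq, MonoidalCategory.whiskerLeft_comp, Category.assoc,
    whiskerLeft_rigidComparison_ev]
  exact whiskerLeft_zigzag η _ zigzag

end Duality

section Invertible

variable {C : Type u} [Category.{v} C] [MonoidalCategory C]

/-- Isomorphic objects define isomorphic functors `a ⊗ -`. -/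
def tensorLeftIsoOfIso {a b : C} (e : a ≅ b) : tensorLeft a ≅ tensorLeft b :=
  (curriedTensor C).mapIso e

/-- If `a ⊗ b ≅ 𝟙` then `a ⊗ -` is left adjoint to `b ⊗ -`. -/
def tensorLeftAdjunctionOfIso [BraidedCategory C] {a b : C} (e : a ⊗ b ≅ 𝟙_ C) :
    tensorLeft a ⊣ tensorLeft b :=
  (CategoryTheory.Equivalence.mk (tensorLeft a) (tensorLeft b)
    ((leftUnitorNatIso C).symm ≪≫ tensorLeftIsoOfIso (e.symm ≪≫ β_ a b) ≪≫ tensorLeftTensor b a)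
    ((tensorLeftTensor a b).symm ≪≫ tensorLeftIsoOfIso e ≪≫ leftUnitorNatIso C)).toAdjunction

end Invertible

section CompactUnit

variable {C : Type u} [Category.{v} C] [MonoidalCategory C] [MonoidalClosed C]

lemma RigidlyCompactlyGenerated.isCompactObj_unit [Preadditive C]
    (hC : RigidlyCompactlyGenerated C) :
    IsCompactObj (𝟙_ C) :=
  (hC.compact_iff_rigid _).2 isRigid_unit

lemma preservesCoproducts_tensorLeft (x : C) : PreservesCoproducts (tensorLeft x) :=
  preservesCoproducts_of_adjunction (ihom.adjunction x)

end CompactUnit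

section CompactDuality

variable {C : Type u} [Category.{v} C] [HasZeroObject C] [Preadditive C] [HasShift C ℤ]
  [∀ n : ℤ, (shiftFunctor C n).Additive] [Pretriangulated C]
  [MonoidalCategory C] [MonoidalClosed C]

lemma RigidlyCompactlyGenerated.isCompactObj_of_tensorLeft_adjunction
    (hC : RigidlyCompactlyGenerated C) {x y : C} (adj : tensorLeft x ⊣ tensorLeft y) :
    IsCompactObj x :=
  (hC.isCompactObj_unit.map adj (preservesCoproducts_tensorLeft y)).of_iso (ρ_ x)

lemma RigidlyCompactlyGenerated.isCompactObj_of_exactPairing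
    (hC : RigidlyCompactlyGenerated C) (x y : C) [ExactPairing x y] : IsCompactObj y :=
  hC.isCompactObj_of_tensorLeft_adjunction (tensorLeftAdjunction x y)

variable [SymmetricCategory C]

lemma RigidlyCompactlyGenerated.isCompactObj_of_tensorInvertible
    (hC : RigidlyCompactlyGenerated C) {x : C} (hx : TensorInvertible x) : IsCompactObj x := by
  obtain ⟨y, ⟨e⟩⟩ := hx
  exact hC.isCompactObj_of_tensorLeft_adjunction (tensorLeftAdjunctionOfIso e)

lemma RigidlyCompactlyGenerated.exists_dual (hC : RigidlyCompactlyGenerated C) {x : C}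
    (hx : IsCompactObj x) :
    ∃ y : C, IsCompactObj y ∧ Nonempty (ExactPairing x y) ∧ Nonempty (ExactPairing y x) := by
  obtain ⟨p⟩ := ((hC.compact_iff_rigid x).1 hx).exactPairing
  let q : ExactPairing x ((ihom x).obj (𝟙_ C)) := BraidedCategory.exactPairing_swap _ _
  exact ⟨_, hC.isCompactObj_of_exactPairing x _, ⟨q⟩, ⟨p⟩⟩

end CompactDuality

section Linear

open MonoidalLeftAction Functor.LaxLeftLinear Functor.OplaxLeftLinear

universe w₁ w₂ w₃ v₁ v₂ v₃

variable {A : Type w₁} [Category.{v₁} A] [MonoidalCategory A]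
  {M : Type w₂} [Category.{v₂} M] [MonoidalLeftAction A M]
  {N : Type w₃} [Category.{v₃} N] [MonoidalLeftAction A N]

/-- The right adjoint of an oplax linear functor is lax linear. -/
@[reducible]
def laxLeftLinearOfAdjunction {F : M ⥤ N} {G : N ⥤ M} (adj : F ⊣ G) [F.OplaxLeftLinear A] :
    G.LaxLeftLinear A where
  μₗ a n := adj.homEquiv _ _ (δₗ F a (G.obj n) ≫ a ⊴ₗ adj.counit.app n)
  μₗ_naturality_left f n := by
    rw [← adj.homEquiv_naturality_left, ← adj.homEquiv_naturality_right,
      δₗ_naturality_left_assoc, Category.assoc, action_exchange]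
  μₗ_naturality_right a n n' f := by
    rw [← adj.homEquiv_naturality_left, ← adj.homEquiv_naturality_right,
      δₗ_naturality_right_assoc, Category.assoc, ← actionHomRight_comp, ← actionHomRight_comp,
      adj.counit_naturality]
  μₗ_associativity a b n := by
    rw [← adj.homEquiv_naturality_right, ← adj.homEquiv_naturality_left,
      ← adj.homEquiv_naturality_left]
    congr 1
    rw [δₗ_naturality_right_assoc, ← actionHomRight_comp]
    rw [← adj.homEquiv_counit, Equiv.symm_apply_apply, actionHomRight_comp,
      ← δₗ_associativity_assoc, Category.assoc,
      tensor_actionHomRight]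
    simp
  μₗ_unitality n := by
    rw [← adj.homEquiv_naturality_right]
    apply (adj.homEquiv _ _).symm.injective
    rw [Equiv.symm_apply_apply, adj.homEquiv_counit, Category.assoc,
      ← actionUnitIso_hom_naturality, ← Category.assoc]
    congr 1
    rw [← cancel_epi (F.map (λₗ[A] (G.obj n)).inv), ← δₗ_unitality_inv_assoc, ← F.map_comp]
    simp

/-- The zigzag identity of an exact pairing, in a module category. -/
lemma action_zigzag (a b : A) [ExactPairing a b] (m : M) :
    (λₗ[A] (a ⊙ₗ m)).inv ≫ η_ a b ⊵ₗ (a ⊙ₗ m) ≫ (αₗ a b (a ⊙ₗ m)).hom ≫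
      a ⊴ₗ ((αₗ b a m).inv ≫ ε_ a b ⊵ₗ m ≫ (λₗ[A] m).hom) = 𝟙 (a ⊙ₗ m) := by
  have h : η_ a b ▷ a ≫ (α_ a b a).hom ≫ a ◁ ε_ a b = (λ_ a).hom ≫ (ρ_ a).inv :=
    ExactPairing.evaluation_coevaluation _ _
  have h' : (η_ a b ▷ a) ⊵ₗ m ≫ (α_ a b a).hom ⊵ₗ m ≫ (a ◁ ε_ a b) ⊵ₗ m =
      (λ_ a).hom ⊵ₗ m ≫ (ρ_ a).inv ⊵ₗ m := by
    rw [← comp_actionHomLeft, ← comp_actionHomLeft, h, comp_actionHomLeft]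
  have e : (αₗ a b (a ⊙ₗ m)).hom ≫ a ⊴ₗ (αₗ b a m).inv =
      (αₗ (a ⊗ b) a m).inv ≫ (α_ a b a).hom ⊵ₗ m ≫ (αₗ a (b ⊗ a) m).hom := by
    rw [Iso.eq_inv_comp, ← associator_actionHom_assoc, ← actionHomRight_comp]
    simp
  have e' : (ρ_ a).inv ⊵ₗ m ≫ (αₗ a (𝟙_ A) m).hom ≫ a ⊴ₗ (λₗ[A] m).hom = 𝟙 _ := by
    rw [← rightUnitor_actionHom, ← comp_actionHomLeft, Iso.inv_hom_id, id_actionHomLeft]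
  rw [actionHomRight_comp, actionHomRight_comp, reassoc_of% e, actionHomLeft_action]
  rw [← cancel_epi (λₗ[A] (a ⊙ₗ m)).hom, ← cancel_epi (αₗ (𝟙_ A) a m).hom]
  simp only [Category.assoc, Iso.hom_inv_id_assoc, Category.comp_id]
  rw [← leftUnitor_actionHom]
  have e'' : (αₗ a (b ⊗ a) m).hom ≫ a ⊴ₗ ε_ a b ⊵ₗ m =
      (a ◁ ε_ a b) ⊵ₗ m ≫ (αₗ a (𝟙_ A) m).hom := by
    rw [whiskerLeft_actionHomLeft, Category.assoc, Category.assoc, Iso.inv_hom_id,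
      Category.comp_id]
  rw [reassoc_of% e'', reassoc_of% h', e', Category.comp_id]

/-- A lax linear functor commutes with the action of dualizable objects. -/
lemma isIso_μₗ_of_exactPairing (G : N ⥤ M) [G.LaxLeftLinear A] (a b : A) [ExactPairing a b]
    (n : N) : IsIso (μₗ G a n) := by
  refine ⟨(λₗ[A] (G.obj (a ⊙ₗ n))).inv ≫ η_ a b ⊵ₗ _ ≫ (αₗ a b _).hom ≫
    a ⊴ₗ (μₗ G b (a ⊙ₗ n) ≫ G.map ((αₗ b a n).inv ≫ ε_ a b ⊵ₗ n ≫ (λₗ[A] n).hom)), ?_, ?_⟩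
  · have e : b ⊴ₗ μₗ G a n ≫ μₗ G b (a ⊙ₗ n) ≫
        G.map ((αₗ b a n).inv ≫ ε_ a b ⊵ₗ n ≫ (λₗ[A] n).hom) =
        (αₗ b a (G.obj n)).inv ≫ ε_ a b ⊵ₗ G.obj n ≫ (λₗ[A] (G.obj n)).hom := by
      rw [G.map_comp, G.map_comp, μₗ_associativity_inv_assoc, ← μₗ_naturality_left_assoc,
        ← μₗ_unitality]
    rw [← actionUnitIso_inv_naturality_assoc, action_exchange_assoc, tensor_actionHomRight]
    simp only [Category.assoc, Iso.inv_hom_id_assoc]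
    rw [← actionHomRight_comp, e, action_zigzag]
  · simp only [Category.assoc]
    rw [actionHomRight_comp, Category.assoc, μₗ_naturality_right, ← μₗ_associativity_assoc,
      μₗ_naturality_left_assoc, μₗ_unitality_inv_assoc, ← G.map_comp, ← G.map_comp,
      ← G.map_comp, action_zigzag, G.map_id]

end Linear

section Pullback

open MonoidalLeftAction Functor.LaxLeftLinear Functor.OplaxLeftLinear

variable {D : Type u₁} {C : Type u₂} [Category.{v} D] [Category.{v} C]
  [MonoidalCategory D] [MonoidalCategory C]

/-- The action `d ⊙ c = F d ⊗ c` of `D` on `C` through a monoidal functor `F : D ⥤ C`. -/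
@[reducible]
def pullbackAction (F : D ⥤ C) [F.Monoidal] : MonoidalLeftAction D C where
  actionObj d c := F.obj d ⊗ c
  actionHomLeft f c := F.map f ▷ c
  actionHomRight d _ _ g := F.obj d ◁ g
  actionHom f g := F.map f ⊗ₘ g
  actionAssocIso d d' c := whiskerRightIso (Functor.Monoidal.μIso F d d').symm c ≪≫ α_ _ _ _
  actionUnitIso c := whiskerRightIso (Functor.Monoidal.εIso F).symm c ≪≫ λ_ c
  actionHom_def := by simp [MonoidalCategory.tensorHom_def]
  actionAssocIso_hom_naturality f g h := by
    simp only [Iso.trans_hom, whiskerRightIso_hom, Iso.symm_hom, Functor.Monoidal.μIso_inv]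
    rw [Category.assoc, ← associator_naturality, ← tensorHom_id, ← tensorHom_id,
      tensorHom_comp_tensorHom_assoc, tensorHom_comp_tensorHom_assoc,
      Functor.OplaxMonoidal.δ_natural, Category.id_comp, Category.comp_id]
  actionUnitIso_hom_naturality f := by
    simp [whisker_exchange_assoc]
  whiskerLeft_actionHomLeft d _ _ f c := by
    rw [Functor.Monoidal.map_whiskerLeft]
    simp only [comp_whiskerRight, whisker_assoc, Category.assoc, Iso.trans_hom,
      whiskerRightIso_hom, Iso.symm_hom, Functor.Monoidal.μIso_inv, Iso.trans_inv,
      whiskerRightIso_inv, Iso.symm_inv, Functor.Monoidal.μIso_hom]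
  whiskerRight_actionHomLeft _ f c := by
    rw [Functor.Monoidal.map_whiskerRight]
    simp only [comp_whiskerRight, whiskerRight_tensor, Category.assoc, Iso.hom_inv_id_assoc,
      Iso.trans_hom, whiskerRightIso_hom, Iso.symm_hom, Functor.Monoidal.μIso_inv, Iso.trans_inv,
      whiskerRightIso_inv, Iso.symm_inv, Functor.Monoidal.μIso_hom]
  associator_actionHom d₁ d₂ d₃ c := by
    have h := congr($(Functor.OplaxMonoidal.associativity F d₁ d₂ d₃) ▷ c ≫ (α_ _ _ _).hom ≫
      F.obj d₁ ◁ (α_ _ _ _).hom)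
    simpa [-Functor.OplaxMonoidal.associativity] using h.symm
  leftUnitor_actionHom d c := by
    rw [Functor.Monoidal.map_leftUnitor]
    simp only [Iso.trans_hom, whiskerRightIso_hom, Iso.symm_hom, Functor.Monoidal.μIso_inv,
      Functor.Monoidal.εIso_inv]
    monoidal
  rightUnitor_actionHom d c := by
    rw [Functor.Monoidal.map_rightUnitor]
    simp only [Iso.trans_hom, whiskerRightIso_hom, Iso.symm_hom, Functor.Monoidal.μIso_inv,
      Functor.Monoidal.εIso_inv]
    monoidal

/-- A monoidal functor is linear over its source. -/
@[reducible]
def oplaxLeftLinearPullback (F : D ⥤ C) [F.Monoidal] :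
    letI := pullbackAction F
    F.OplaxLeftLinear D :=
  letI := pullbackAction F
  { δₗ := fun d d' => Functor.OplaxMonoidal.δ F d d' 
    δₗ_naturality_left := fun f d => (Functor.OplaxMonoidal.δ_natural_left F f d).symm
    δₗ_naturality_right := fun d _ _ f => (Functor.OplaxMonoidal.δ_natural_right F d f).symm
    δₗ_associativity := fun d d' d'' => by
      refine Eq.trans (congrArg (Functor.OplaxMonoidal.δ F (d ⊗ d') d'' ≫ ·) ?_)
        (Functor.OplaxMonoidal.associativity F d d' d'')
      rfl
    δₗ_unitality_inv := fun d => by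
      change (λ_ (F.obj d)).inv ≫ Functor.LaxMonoidal.ε F ▷ F.obj d =
        F.map (λ_ d).inv ≫ Functor.OplaxMonoidal.δ F (𝟙_ D) d
      simp [Functor.OplaxMonoidal.left_unitality] }

end Pullback

section Linear

open MonoidalLeftAction Functor.LaxLeftLinear Functor.OplaxLeftLinear

universe w₁ w₂ w₃ v₁ v₂ v₃

variable {A : Type w₁} [Category.{v₁} A] [MonoidalCategory A]
  {M : Type w₂} [Category.{v₂} M] [MonoidalLeftAction A M]
  {N : Type w₃} [Category.{v₃} N] [MonoidalLeftAction A N]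

/-- A lax linear functor with invertible structure maps is oplax linear. -/
@[reducible]
def oplaxLeftLinearOfIsIso (G : M ⥤ N) [G.LaxLeftLinear A] [∀ (a : A) (m : M), IsIso (μₗ G a m)] :
    G.OplaxLeftLinear A where
  δₗ a m := inv (μₗ G a m)
  δₗ_naturality_left f m := by
    rw [IsIso.eq_inv_comp, ← μₗ_naturality_left_assoc, IsIso.hom_inv_id, Category.comp_id]
  δₗ_naturality_right a _ _ f := by
    rw [IsIso.eq_inv_comp, ← μₗ_naturality_right_assoc, IsIso.hom_inv_id, Category.comp_id]
  δₗ_associativity a b m := by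
    rw [IsIso.inv_comp_eq, μₗ_associativity_assoc, IsIso.hom_inv_id_assoc, ← actionHomRight_comp,
      IsIso.hom_inv_id]
    simp
  δₗ_unitality_inv m := by
    rw [IsIso.eq_comp_inv, μₗ_unitality_inv]

end Linear

section ProjectionFormula

open MonoidalLeftAction Functor.LaxLeftLinear Functor.OplaxLeftLinear

variable {D : Type u₁} {C : Type u₂} [Category.{v} D] [Category.{v} C]
  [MonoidalCategory D] [MonoidalCategory C] {fstar : D ⥤ C} [fstar.Monoidal] {fpush : C ⥤ D}

lemma projFormula_naturality_left (adj : fstar ⊣ fpush) {d d' : D} (f : d ⟶ d') (y : C) :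
    f ▷ fpush.obj y ≫ projFormula fstar fpush adj d' y =
      projFormula fstar fpush adj d y ≫ fpush.map (fstar.map f ▷ y) :=
  let _ := pullbackAction fstar
  let _ := oplaxLeftLinearPullback fstar
  let _ := laxLeftLinearOfAdjunction (A := D) adj
  μₗ_naturality_left fpush f y

lemma isIso_projFormula_of_exactPairing (adj : fstar ⊣ fpush) (d dual : D) [ExactPairing d dual]
    (y : C) : IsIso (projFormula fstar fpush adj d y) :=
  let _ := pullbackAction fstar
  let _ := oplaxLeftLinearPullback fstar
  let _ := laxLeftLinearOfAdjunction (A := D) adj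
  isIso_μₗ_of_exactPairing fpush d dual y

/-- In a closed braided category, tensoring on the right is a left adjoint. -/
def tensorRightAdj {A : Type u} [Category.{v} A] [MonoidalCategory A] [BraidedCategory A]
    [MonoidalClosed A] (x : A) : tensorRight x ⊣ ihom x :=
  (ihom.adjunction x).ofNatIsoLeft (BraidedCategory.tensorLeftIsoTensorRight x)

variable [Preadditive D] [HasZeroObject D] [HasShift D ℤ]
    [∀ n : ℤ, (shiftFunctor D n).Additive] [Pretriangulated D]
    [SymmetricCategory D] [MonoidalClosed D] [SymmetricCategory C] [MonoidalClosed C]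
    {fone : D ⥤ C}

lemma isIso_projFormula (hD : RigidlyCompactlyGenerated D)
    (adj1 : fstar ⊣ fpush) (adj2 : fpush ⊣ fone) (d : D) (y : C) :
    IsIso (projFormula fstar fpush adj1 d y) := by
  let τ : tensorRight (fpush.obj y) ⟶ fstar ⋙ tensorRight y ⋙ fpush :=
    { app := fun d => projFormula fstar fpush adj1 d y
      naturality := fun _ _ f => projFormula_naturality_left adj1 f y }
  have : IsIso τ := isIso_of_isIso_compact hD.exists_generators (tensorRightAdj (fpush.obj y))
    (adj1.comp ((tensorRightAdj y).comp adj2)) τ fun d hd => by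
      obtain ⟨d', -, ⟨_⟩, -⟩ := hD.exists_dual hd
      exact isIso_projFormula_of_exactPairing adj1 d d' y
  exact NatIso.isIso_app_of_isIso τ d

lemma nonempty_tensorLeft_fone_iso (hD : RigidlyCompactlyGenerated D)
    (adj1 : fstar ⊣ fpush) (adj2 : fpush ⊣ fone) {fm1 : C ⥤ D}
    (adjR : fone ⊣ fm1) : Nonempty (fstar ⋙ tensorLeft (fone.obj (𝟙_ D)) ≅ fone) := by
  let _ := pullbackAction fstar
  let _ := oplaxLeftLinearPullback fstar
  let _ := laxLeftLinearOfAdjunction (A := D) adj1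
  have (d : D) (y : C) : IsIso (μₗ fpush d y) := isIso_projFormula hD adj1 adj2 d y
  let _ := oplaxLeftLinearOfIsIso (A := D) fpush
  let _ := laxLeftLinearOfAdjunction (A := D) adj2
  let τ : fstar ⋙ tensorRight (fone.obj (𝟙_ D)) ⟶ fone :=
    { app := fun d => μₗ fone d (𝟙_ D) ≫ fone.map (ρ_ d).hom
      naturality := fun d d' f => by
        have := μₗ_naturality_left fone f (𝟙_ D)
        change fstar.map f ▷ fone.obj (𝟙_ D) ≫ μₗ fone d' (𝟙_ D) ≫ fone.map (ρ_ d').hom =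
          (μₗ fone d (𝟙_ D) ≫ fone.map (ρ_ d).hom) ≫ fone.map f
        change fstar.map f ▷ fone.obj (𝟙_ D) ≫ μₗ fone d' (𝟙_ D) =
          μₗ fone d (𝟙_ D) ≫ fone.map (f ▷ 𝟙_ D) at this
        rw [Category.assoc, reassoc_of% this, ← fone.map_comp, ← fone.map_comp,
          rightUnitor_naturality] }
  have : IsIso τ := isIso_of_isIso_compact hD.exists_generators
    (adj1.comp (tensorRightAdj (fone.obj (𝟙_ D)))) adjR τ fun d hd => by
      obtain ⟨d', -, ⟨_⟩, -⟩ := hD.exists_dual hd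
      have : IsIso (μₗ fone d (𝟙_ D)) := isIso_μₗ_of_exactPairing fone d d' (𝟙_ D)
      exact inferInstanceAs (IsIso (μₗ fone d (𝟙_ D) ≫ fone.map (ρ_ d).hom))
  exact ⟨Functor.isoWhiskerLeft fstar (BraidedCategory.tensorLeftIsoTensorRight _) ≪≫ asIso τ⟩

end ProjectionFormula

section PerfectPairing

universe w

variable {A : Type w} [Category.{v} A] [MonoidalCategory A]

/-- Maps into the dual `r'` of `r` are pairings with `r`. -/
lemma bijective_whiskerRight_evaluation (z r r' d : A) [ExactPairing r r'] :
    Function.Bijective (fun k : d ⟶ z ⊗ r' =>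
      k ▷ r ≫ (α_ z r' r).hom ≫ z ◁ ε_ r r' ≫ (ρ_ z).hom) :=
  (tensorRightHomEquiv d r r' z).symm.bijective

lemma bijective_evaluation (r r' d : A) [ExactPairing r r'] :
    Function.Bijective (fun k : d ⟶ r' => k ▷ r ≫ ε_ r r') := by
  have e : (fun k : d ⟶ r' => k ▷ r ≫ ε_ r r') =
      (tensorRightHomEquiv d r r' (𝟙_ A)).symm ∘ (λ_ r').symm.homToEquiv := by
    ext k
    simp [tensorRightHomEquiv, ← unitors_equal]
  rw [e]
  exact (Equiv.bijective _).comp (Equiv.bijective _)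

/-- Elements of a dualizable object `r` are functionals on the dual of `r`. -/
lemma bijective_functional (r r' : A) [ExactPairing r r'] :
    Function.Bijective (fun s : 𝟙_ A ⟶ r => (ρ_ r').inv ≫ r' ◁ s ≫ ε_ r r') := by
  have e : (fun s : 𝟙_ A ⟶ r => (ρ_ r').inv ≫ r' ◁ s ≫ ε_ r r') =
      ((ρ_ r').homFromEquiv) ∘ (tensorLeftHomEquiv (𝟙_ A) r r' (𝟙_ A)).symm ∘
        ((ρ_ r).symm.homToEquiv) := by
    ext s
    simp [tensorLeftHomEquiv, unitors_equal]
  rw [e]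
  exact (Equiv.bijective _).comp ((Equiv.bijective _).comp (Equiv.bijective _))

/-- A pairing `b ⊗ r ⟶ 𝟙` such that maps into `b` are pairings with the dualizable object `r`
identifies `b` with the dual of `r`. -/
lemma exists_iso_of_perfect {b r : A} (r' : A) [ExactPairing r r']
    (P : b ⊗ r ⟶ 𝟙_ A)
    (hP : ∀ d : A, Function.Bijective (fun k : d ⟶ b => k ▷ r ≫ P)) :
    ∃ i : r' ≅ b, i.inv ▷ r ≫ ε_ r r' = P := by
  have hε := bijective_evaluation r r'
  obtain ⟨k, hk⟩ := (hP r').2 (ε_ r r')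
  obtain ⟨j, hj⟩ := (hε b).2 P
  dsimp only at hk hj
  have hjk : j ≫ k = 𝟙 b := (hP b).1 (by simp [hk, hj])
  have hkj : k ≫ j = 𝟙 r' := (hε r').1 (by simp [hk, hj])
  exact ⟨⟨k, j, hkj, hjk⟩, hj⟩

/-- A pairing `b ⊗ r ⟶ 𝟙` identifying `b` with the dual of the dualizable object `r`
identifies the elements of `r` with the functionals on `b`. -/
lemma bijective_functional_of_perfect {b r : A} (r' : A) [ExactPairing r r']
    (P : b ⊗ r ⟶ 𝟙_ A)
    (hP : ∀ d : A, Function.Bijective (fun k : d ⟶ b => k ▷ r ≫ P)) :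
    Function.Bijective (fun s : 𝟙_ A ⟶ r => (ρ_ b).inv ≫ b ◁ s ≫ P) := by
  obtain ⟨i, hi⟩ := exists_iso_of_perfect r' P hP
  have e : (fun s : 𝟙_ A ⟶ r => (ρ_ b).inv ≫ b ◁ s ≫ P) =
      i.homFromEquiv ∘ fun s => (ρ_ r').inv ≫ r' ◁ s ≫ ε_ r r' := by
    ext s
    simp [← hi, whisker_exchange_assoc]
  rw [e]
  exact (Equiv.bijective _).comp (bijective_functional r r')

end PerfectPairing

section UnitPairing

variable {D : Type u₁} {C : Type u₂} [Category.{v} D] [Category.{v} C]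
  [MonoidalCategory D] [MonoidalCategory C] {fstar : D ⥤ C} [fstar.Monoidal] {fpush : C ⥤ D}

/-- The lax monoidal structure of the direct image. -/
def pushMu (adj : fstar ⊣ fpush) (a b : C) : fpush.obj a ⊗ fpush.obj b ⟶ fpush.obj (a ⊗ b) :=
  letI := adj.rightAdjointLaxMonoidal
  Functor.LaxMonoidal.μ fpush a b

lemma whiskerRight_pushMu (adj : fstar ⊣ fpush) {d : D} {a : C} (k : fstar.obj d ⟶ a) (b : C) :
    adj.homEquiv _ _ k ▷ fpush.obj b ≫ pushMu adj a b =
      projFormula fstar fpush adj d b ≫ fpush.map (k ▷ b) := by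
  change _ ≫ adj.homEquiv _ _ (_ ≫ (adj.counit.app a ⊗ₘ adj.counit.app b)) =
    adj.homEquiv _ _ (_ ≫ _) ≫ _
  rw [← adj.homEquiv_naturality_left, ← adj.homEquiv_naturality_right,
    ← Functor.OplaxMonoidal.δ_natural_left_assoc, Category.assoc]
  have h : fstar.map (adj.homEquiv _ _ k) ≫ adj.counit.app a = k := 
    (adj.homEquiv_counit _ _ _).symm.trans (Equiv.symm_apply_apply _ _)
  congr 2
  change fstar.map (adj.homEquiv _ _ k) ▷ fstar.obj (fpush.obj b) ≫
    ((show fstar.obj (fpush.obj a) ⟶ a from adj.counit.app a) ⊗ₘ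
      (show fstar.obj (fpush.obj b) ⟶ b from adj.counit.app b)) =
    fstar.obj d ◁ (show fstar.obj (fpush.obj b) ⟶ b from adj.counit.app b) ≫ k ▷ b
  rw [MonoidalCategory.tensorHom_def, ← comp_whiskerRight_assoc, h, whisker_exchange]

lemma whiskerLeft_pushMu (adj : fstar ⊣ fpush) (a : C) {b : C} (t : fstar.obj (𝟙_ D) ⟶ b) :
    (ρ_ (fpush.obj a)).inv ≫ fpush.obj a ◁ adj.homEquiv _ _ t ≫ pushMu adj a b =
      fpush.map ((ρ_ a).inv ≫ a ◁ (Functor.LaxMonoidal.ε fstar ≫ t)) := by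
  let _ := adj.rightAdjointLaxMonoidal
  have h : adj.homEquiv _ _ t =
      Functor.LaxMonoidal.ε fpush ≫ fpush.map (Functor.LaxMonoidal.ε fstar ≫ t) := by
    change _ = adj.homEquiv _ _ (Functor.OplaxMonoidal.η fstar) ≫ _
    rw [← adj.homEquiv_naturality_right]
    simp
  rw [h]
  change _ ≫ _ ≫ Functor.LaxMonoidal.μ fpush a b = _
  simp

end UnitPairing

section PushPairing

variable {D : Type u₁} {C : Type u₂}
    [Category.{v} D] [Preadditive D] [HasZeroObject D] [HasShift D ℤ]
    [∀ n : ℤ, (shiftFunctor D n).Additive] [Pretriangulated D]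
    [MonoidalCategory D] [SymmetricCategory D] [MonoidalClosed D]
    [Category.{v} C] [MonoidalCategory C] [SymmetricCategory C] [MonoidalClosed C]
    {fstar : D ⥤ C} [fstar.Monoidal] {fpush : C ⥤ D} {fone : D ⥤ C}

/-- The pairing `f_*(ω ⊗ x) ⊗ f_*(y) ⟶ 𝟙` induced by a duality between `x` and `y`. -/
def pushPairing (adj1 : fstar ⊣ fpush) (adj2 : fpush ⊣ fone) (x y : C) [ExactPairing y x] :
    fpush.obj (fone.obj (𝟙_ D) ⊗ x) ⊗ fpush.obj y ⟶ 𝟙_ D :=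
  pushMu adj1 (fone.obj (𝟙_ D) ⊗ x) y ≫ (adj2.homEquiv _ _).symm
    ((α_ (fone.obj (𝟙_ D)) x y).hom ≫ fone.obj (𝟙_ D) ◁ ε_ y x ≫ (ρ_ (fone.obj (𝟙_ D))).hom)

lemma bijective_pushPairing (hD : RigidlyCompactlyGenerated D)
    (adj1 : fstar ⊣ fpush) (adj2 : fpush ⊣ fone) (x y : C) [ExactPairing y x] (d : D) :
    Function.Bijective (fun k : d ⟶ fpush.obj (fone.obj (𝟙_ D) ⊗ x) =>
      k ▷ fpush.obj y ≫ pushPairing adj1 adj2 x y) := by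
  have := isIso_projFormula hD adj1 adj2 d y
  have e : (fun k : d ⟶ fpush.obj (fone.obj (𝟙_ D) ⊗ x) =>
        k ▷ fpush.obj y ≫ pushPairing adj1 adj2 x y) ∘
        adj1.homEquiv d (fone.obj (𝟙_ D) ⊗ x) =
      (asIso (projFormula fstar fpush adj1 d y)).symm.homFromEquiv ∘
        (adj2.homEquiv _ _).symm ∘ fun k => k ▷ y ≫ (α_ (fone.obj (𝟙_ D)) x y).hom ≫
          fone.obj (𝟙_ D) ◁ ε_ y x ≫ (ρ_ (fone.obj (𝟙_ D))).hom := by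
    ext k
    dsimp only [Function.comp_apply, pushPairing]
    rw [← Category.assoc, whiskerRight_pushMu, Category.assoc,
      ← adj2.homEquiv_naturality_left_symm]
    rfl
  rw [← Function.Bijective.of_comp_iff _ (adj1.homEquiv d _).bijective, e]
  exact (Equiv.bijective _).comp ((Equiv.bijective _).comp
    (bijective_whiskerRight_evaluation (fone.obj (𝟙_ D)) y x (fstar.obj d)))

end PushPairing

section DualizingUnit

variable {D : Type u₁} {C : Type u₂}
    [Category.{v} D] [Preadditive D] [HasZeroObject D] [HasShift D ℤ]
    [∀ n : ℤ, (shiftFunctor D n).Additive] [Pretriangulated D]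
    [MonoidalCategory D] [SymmetricCategory D] [MonoidalClosed D]
    [Category.{v} C] [Preadditive C] [HasZeroObject C] [HasShift C ℤ]
    [∀ n : ℤ, (shiftFunctor C n).Additive] [Pretriangulated C]
    [MonoidalCategory C] [SymmetricCategory C] [MonoidalClosed C]
    {fstar : D ⥤ C} [fstar.Monoidal] {fpush : C ⥤ D} {fone : D ⥤ C} {fm1 : C ⥤ D}

/-- The functor `f_*(ω ⊗ -)` preserves compact objects. -/
lemma isCompactObj_push_dualizing (hD : RigidlyCompactlyGenerated D)
    (hC : RigidlyCompactlyGenerated C) (adj1 : fstar ⊣ fpush) (adj2 : fpush ⊣ fone)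
    (adjR : fone ⊣ fm1) {x : C} (hx : IsCompactObj x) :
    IsCompactObj (fpush.obj (fone.obj (𝟙_ D) ⊗ x)) := by
  obtain ⟨y, hy, -, ⟨_⟩⟩ := hC.exists_dual hx
  have hr : IsCompactObj (fpush.obj y) := hy.map adj2 (preservesCoproducts_of_adjunction adjR)
  obtain ⟨r', hr', ⟨_⟩, -⟩ := hD.exists_dual hr
  obtain ⟨i, -⟩ := exists_iso_of_perfect r' _ (bijective_pushPairing hD adj1 adj2 x y)
  exact hr'.of_iso i

/-- Endomorphisms of the dualizing object `ω`, twisted by a compact object `x`, are given by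
functionals on `x`. -/
lemma bijective_whiskerLeft_dualizing (hD : RigidlyCompactlyGenerated D)
    (hC : RigidlyCompactlyGenerated C) (adj1 : fstar ⊣ fpush) (adj2 : fpush ⊣ fone)
    (adjR : fone ⊣ fm1) {x : C} (hx : IsCompactObj x) :
    Function.Bijective (fun h : x ⟶ 𝟙_ C =>
      fone.obj (𝟙_ D) ◁ h ≫ (ρ_ (fone.obj (𝟙_ D))).hom) := by
  obtain ⟨y, hy, -, ⟨_⟩⟩ := hC.exists_dual hx
  have hr : IsCompactObj (fpush.obj y) := hy.map adj2 (preservesCoproducts_of_adjunction adjR)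
  obtain ⟨r', -, ⟨_⟩, -⟩ := hD.exists_dual hr
  have hs := bijective_functional_of_perfect r' _ (bijective_pushPairing hD adj1 adj2 x y)
  set ω := fone.obj (𝟙_ D)
  let Φ : (fstar.obj (𝟙_ D) ⟶ y) → (x ⟶ 𝟙_ C) := fun t =>
    (ρ_ x).inv ≫ x ◁ (Functor.LaxMonoidal.ε fstar ≫ t) ≫ ε_ y x
  have hΦ : Function.Bijective Φ :=
    (bijective_functional y x).comp ((Functor.Monoidal.εIso fstar).symm.homFromEquiv).bijective
  rw [← Function.Bijective.of_comp_iff _ hΦ,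
    ← Function.Bijective.of_comp_iff' (adj2.homEquiv (ω ⊗ x) (𝟙_ D)).symm.bijective]
  have e : (adj2.homEquiv (ω ⊗ x) (𝟙_ D)).symm ∘
      (fun h : x ⟶ 𝟙_ C => ω ◁ h ≫ (ρ_ ω).hom) ∘ Φ =
      (fun s : 𝟙_ D ⟶ fpush.obj y => (ρ_ (fpush.obj (ω ⊗ x))).inv ≫
        fpush.obj (ω ⊗ x) ◁ s ≫ pushPairing adj1 adj2 x y) ∘ adj1.homEquiv _ _ := by
    ext t
    dsimp only [Function.comp_apply, pushPairing, Φ]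
    have h := whiskerLeft_pushMu adj1 (ω ⊗ x) t
    rw [reassoc_of% h, ← adj2.homEquiv_naturality_left_symm]
    congr 1
    monoidal
  rw [e]
  exact hs.comp (Equiv.bijective _)

end DualizingUnit

section Conjugate

universe w₁ w₂ v₁ v₂

variable {A : Type w₁} {B : Type w₂} [Category.{v₁} A] [Category.{v₂} B]
  {L₁ L₂ : A ⥤ B} {R₁ R₂ : B ⥤ A}

lemma isIso_conjugateEquiv_symm_app (adj₁ : L₁ ⊣ R₁) (adj₂ : L₂ ⊣ R₂) (τ : R₁ ⟶ R₂) (a : A)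
    (h₁ : IsIso (τ.app (L₁.obj a))) (h₂ : IsIso (τ.app (L₂.obj a))) :
    IsIso (((conjugateEquiv adj₁ adj₂).symm τ).app a) := by
  set b := ((conjugateEquiv adj₁ adj₂).symm τ).app a with hb
  have h (d : B) (hd : IsIso (τ.app d)) :
      Function.Bijective (fun g : L₁.obj a ⟶ d => b ≫ g) := by
    have e : (fun g : L₁.obj a ⟶ d => b ≫ g) =
        (adj₂.homEquiv a d).symm ∘ (asIso (τ.app d)).homToEquiv ∘ adj₁.homEquiv a d := by
      ext g
      dsimp only [Function.comp_apply]
      rw [Equiv.eq_symm_apply, adj₂.homEquiv_unit, R₂.map_comp, hb]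
      change adj₂.unit.app a ≫ R₂.map (((conjugateEquiv adj₁ adj₂).symm τ).app a) ≫ R₂.map g =
        adj₁.homEquiv a d g ≫ τ.app d
      rw [adj₁.homEquiv_unit, Category.assoc, τ.naturality g]
      exact ((Category.assoc _ _ _).symm.trans (congrArg (· ≫ R₂.map g)
        (unit_conjugateEquiv_symm adj₁ adj₂ τ a).symm)).trans (Category.assoc _ _ _)
    rw [e]
    exact (Equiv.bijective _).comp ((Equiv.bijective _).comp (Equiv.bijective _))
  obtain ⟨g, hg⟩ := (h _ h₂).2 (𝟙 _)
  dsimp only at hg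
  exact ⟨g, hg, (h _ h₁).1 (by simp [reassoc_of% hg])⟩

end Conjugate

section DualizingTwist

variable {D : Type u₁} {C : Type u₂}
    [Category.{v} D] [Preadditive D] [HasZeroObject D] [HasShift D ℤ]
    [∀ n : ℤ, (shiftFunctor D n).Additive] [Pretriangulated D]
    [MonoidalCategory D] [SymmetricCategory D] [MonoidalClosed D]
    [Category.{v} C] [Preadditive C] [HasZeroObject C] [HasShift C ℤ]
    [∀ n : ℤ, (shiftFunctor C n).Additive] [Pretriangulated C]
    [MonoidalCategory C] [SymmetricCategory C] [MonoidalClosed C]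
    {fstar : D ⥤ C} [fstar.Monoidal] {fpush : C ⥤ D} {fone : D ⥤ C} {fm1 : C ⥤ D}

/-- Tensoring with the dualizing object is fully faithful on compact objects. -/
lemma bijective_whiskerLeft_dualizing_compact (hD : RigidlyCompactlyGenerated D)
    (hC : RigidlyCompactlyGenerated C) (adj1 : fstar ⊣ fpush) (adj2 : fpush ⊣ fone)
    (adjR : fone ⊣ fm1) {x z : C} (hx : IsCompactObj x) (hz : IsCompactObj z) :
    Function.Bijective (fun h : x ⟶ z => fone.obj (𝟙_ D) ◁ h) := by
  obtain ⟨z', hz', -, ⟨_⟩⟩ := hC.exists_dual hz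
  have hxz : IsCompactObj (x ⊗ z') := by
    obtain ⟨x', -, -, ⟨_⟩⟩ := hC.exists_dual hx
    exact hz'.map (tensorLeftAdjunction x' x) (preservesCoproducts_tensorLeft x')
  set ω := fone.obj (𝟙_ D)
  have hω := bijective_whiskerRight_evaluation ω z' z (ω ⊗ x)
  rw [← Function.Bijective.of_comp_iff' hω]
  have e : (fun k : ω ⊗ x ⟶ ω ⊗ z => k ▷ z' ≫ (α_ ω z z').hom ≫ ω ◁ ε_ z' z ≫ (ρ_ ω).hom) ∘
      (fun h : x ⟶ z => ω ◁ h) =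
      (α_ ω x z').symm.homFromEquiv ∘ (fun g : x ⊗ z' ⟶ 𝟙_ C => ω ◁ g ≫ (ρ_ ω).hom) ∘
        fun h : x ⟶ z => h ▷ z' ≫ ε_ z' z := by
    ext h
    simp
  rw [e]
  exact (Equiv.bijective _).comp
    ((bijective_whiskerLeft_dualizing hD hC adj1 adj2 adjR hxz).comp
      (bijective_evaluation z' z x))

lemma isIso_coev_dualizing (hD : RigidlyCompactlyGenerated D)
    (hC : RigidlyCompactlyGenerated C) (adj1 : fstar ⊣ fpush) (adj2 : fpush ⊣ fone)
    (adjR : fone ⊣ fm1) {z : C} (hz : IsCompactObj z) :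
    IsIso ((ihom.coev (fone.obj (𝟙_ D))).app z) := by
  refine isIso_of_bijective_compact hC.exists_generators _ fun c hc => ?_
  have e : (fun g : c ⟶ z => g ≫ (ihom.coev (fone.obj (𝟙_ D))).app z) =
      (fun k => (ihom.adjunction (fone.obj (𝟙_ D))).homEquiv _ _ k) ∘
        fun g : c ⟶ z => fone.obj (𝟙_ D) ◁ g := by
    ext g
    change _ = curry (fone.obj (𝟙_ D) ◁ g)
    rw [← curry_id_eq_coev, ← curry_natural_left]
    exact congrArg curry (Category.comp_id _)
  have h : Function.Bijective (fun g : c ⟶ z => g ≫ (ihom.coev (fone.obj (𝟙_ D))).app z) := by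
    rw [e]
    exact (Equiv.bijective _).comp
      (bijective_whiskerLeft_dualizing_compact hD hC adj1 adj2 adjR hc hz)
  exact h

/-- If the dualizing object is compact, then it is invertible. -/
lemma tensorInvertible_dualizing (hD : RigidlyCompactlyGenerated D)
    (hC : RigidlyCompactlyGenerated C) (adj1 : fstar ⊣ fpush) (adj2 : fpush ⊣ fone)
    (adjR : fone ⊣ fm1) (hω : IsCompactObj (fone.obj (𝟙_ D))) :
    TensorInvertible (fone.obj (𝟙_ D)) := by
  have := isIso_coev_dualizing hD hC adj1 adj2 adjR hC.isCompactObj_unit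
  have := (hC.compact_iff_rigid _).1 hω (fone.obj (𝟙_ D))
  exact ⟨_, ⟨β_ _ _ ≪≫ asIso (rigidComparison (fone.obj (𝟙_ D)) (fone.obj (𝟙_ D))) ≪≫
    (ihom (fone.obj (𝟙_ D))).mapIso (ρ_ (fone.obj (𝟙_ D))).symm ≪≫
    (asIso ((ihom.coev (fone.obj (𝟙_ D))).app (𝟙_ C))).symm⟩⟩

/-- The left adjoint of `f^*` is `f_*(ω ⊗ -)`. -/
lemma nonempty_push_dualizing_iso (hD : RigidlyCompactlyGenerated D)
    (hC : RigidlyCompactlyGenerated C) {f1 : C ⥤ D} (adjL : f1 ⊣ fstar)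
    (adj1 : fstar ⊣ fpush) (adj2 : fpush ⊣ fone) (adjR : fone ⊣ fm1) :
    Nonempty (tensorLeft (fone.obj (𝟙_ D)) ⋙ fpush ≅ f1) := by
  obtain ⟨γ⟩ := nonempty_tensorLeft_fone_iso hD adj1 adj2 adjR
  let adjW : tensorLeft (fone.obj (𝟙_ D)) ⋙ fpush ⊣ fone ⋙ ihom (fone.obj (𝟙_ D)) :=
    (ihom.adjunction (fone.obj (𝟙_ D))).comp adj2
  let τ : fstar ⟶ fone ⋙ ihom (fone.obj (𝟙_ D)) :=
    Functor.whiskerLeft fstar (ihom.coev (fone.obj (𝟙_ D))) ≫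
      Functor.whiskerRight γ.hom (ihom (fone.obj (𝟙_ D)))
  have hτ (d : D) (hd : IsCompactObj d) : IsIso (τ.app d) := by
    have := isIso_coev_dualizing hD hC adj1 adj2 adjR
      (hd.map adj1 (preservesCoproducts_of_adjunction adj2))
    change IsIso ((ihom.coev (fone.obj (𝟙_ D))).app (fstar.obj d) ≫
      (ihom (fone.obj (𝟙_ D))).map (γ.hom.app d))
    infer_instance
  have : IsIso ((conjugateEquiv adjL adjW).symm τ) :=
    isIso_of_isIso_compact hC.exists_generators adjW adjL _ fun c hc =>
      isIso_conjugateEquiv_symm_app adjL adjW τ c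
        (hτ _ (hc.map adjL (preservesCoproducts_of_adjunction adj1)))
        (hτ _ (isCompactObj_push_dualizing hD hC adj1 adj2 adjR hc))
  exact ⟨asIso ((conjugateEquiv adjL adjW).symm τ)⟩

end DualizingTwist

section Corepresenting

universe w

variable {A : Type w} [Category.{v} A] [MonoidalCategory A]

lemma bijective_whiskerLeft_evaluation (r r' d : A) [ExactPairing r' r] :
    Function.Bijective (fun k : d ⟶ r' => r ◁ k ≫ ε_ r' r) := by
  have e : (fun k : d ⟶ r' => r ◁ k ≫ ε_ r' r) =
      (tensorLeftHomEquiv d r' r (𝟙_ A)).symm ∘ (ρ_ r').symm.homToEquiv := by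
    ext k
    simp [tensorLeftHomEquiv, unitors_equal]
  rw [e]
  exact (Equiv.bijective _).comp (Equiv.bijective _)

/-- The map from the dual of `p` to `z` induced by an element of `z ⊗ p`. -/
def fromDual {z p : A} (η : 𝟙_ A ⟶ z ⊗ p) (p' : A) [ExactPairing p' p] : p' ⟶ z :=
  (λ_ p').inv ≫ η ▷ p' ≫ (α_ z p p').hom ≫ z ◁ ε_ p' p ≫ (ρ_ z).hom

/-- If `p` corepresents the elements of `z ⊗ -`, then the dual of `p` and `z` receive the same
maps from dualizable objects. -/
lemma bijective_fromDual {z p : A} (η : 𝟙_ A ⟶ z ⊗ p)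
    (hη : ∀ x : A, Function.Bijective (fun h : p ⟶ x => η ≫ z ◁ h))
    (p' : A) [ExactPairing p' p] (c c' : A) [ExactPairing c c'] :
    Function.Bijective (fun k : c ⟶ p' => k ≫ fromDual η p') := by
  have e₁ : (fun k : c ⟶ p' => k ≫ fromDual η p') =
      (fun m : p ⊗ c ⟶ 𝟙_ A => (λ_ c).inv ≫ η ▷ c ≫ (α_ z p c).hom ≫ z ◁ m ≫ (ρ_ z).hom) ∘
        fun k => p ◁ k ≫ ε_ p' p := by
    ext k
    simp only [fromDual, Function.comp_apply]
    rw [leftUnitor_inv_naturality_assoc, whisker_exchange_assoc]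
    simp
  have e₂ : (fun m : p ⊗ c ⟶ 𝟙_ A =>
        (λ_ c).inv ≫ η ▷ c ≫ (α_ z p c).hom ≫ z ◁ m ≫ (ρ_ z).hom) ∘
        (fun h : p ⟶ c' => h ▷ c ≫ ε_ c c') =
      (λ_ c).homFromEquiv ∘ (fun k : 𝟙_ A ⟶ z ⊗ c' =>
        k ▷ c ≫ (α_ z c' c).hom ≫ z ◁ ε_ c c' ≫ (ρ_ z).hom) ∘ fun h => η ≫ z ◁ h := by
    ext h
    simp
  rw [e₁]
  refine Function.Bijective.comp ?_ (bijective_whiskerLeft_evaluation p p' c)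
  rw [← Function.Bijective.of_comp_iff _ (bijective_evaluation c c' p), e₂]
  exact (Equiv.bijective _).comp ((bijective_whiskerRight_evaluation z c c' (𝟙_ A)).comp (hη c'))

end Corepresenting

section LeftAdjoint

variable {D : Type u₁} {C : Type u₂}
    [Category.{v} D] [Preadditive D] [MonoidalCategory D] [MonoidalClosed D]
    [Category.{v} C] [Preadditive C] [HasZeroObject C] [HasShift C ℤ]
    [∀ n : ℤ, (shiftFunctor C n).Additive] [Pretriangulated C]
    [MonoidalCategory C] [SymmetricCategory C] [MonoidalClosed C]
    {fstar : D ⥤ C} [fstar.Monoidal] {fpush : C ⥤ D} {fone : D ⥤ C}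

/-- If `f_*(z ⊗ -)` has a left adjoint, then `z` is compact. -/
lemma isCompactObj_of_adjunction_push (hD : RigidlyCompactlyGenerated D)
    (hC : RigidlyCompactlyGenerated C) (adj1 : fstar ⊣ fpush) (adj2 : fpush ⊣ fone)
    {z : C} {g : D ⥤ C} (adj : g ⊣ tensorLeft z ⋙ fpush) : IsCompactObj z := by
  have hv : IsCompactObj (g.obj (𝟙_ D)) := hD.isCompactObj_unit.map adj
    (preservesCoproducts_of_adjunction ((ihom.adjunction z).comp adj2))
  let η : 𝟙_ C ⟶ z ⊗ g.obj (𝟙_ D) := Functor.LaxMonoidal.ε fstar ≫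
    (adj1.homEquiv (𝟙_ D) (z ⊗ g.obj (𝟙_ D))).symm (adj.homEquiv _ _ (𝟙 _))
  have hη (x : C) : Function.Bijective (fun h : g.obj (𝟙_ D) ⟶ x => η ≫ z ◁ h) := by
    have e : (fun h : g.obj (𝟙_ D) ⟶ x => η ≫ z ◁ h) =
        (Functor.Monoidal.εIso fstar).symm.homFromEquiv ∘
          (adj1.homEquiv (𝟙_ D) (z ⊗ x)).symm ∘ adj.homEquiv (𝟙_ D) x := by
      ext h
      dsimp only [Function.comp_apply, η]
      rw [Category.assoc, ← adj1.homEquiv_naturality_right_symm]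
      have h' := adj.homEquiv_naturality_right (𝟙 (g.obj (𝟙_ D))) h
      rw [Category.id_comp] at h'
      rw [h']
      rfl
    rw [e]
    exact (Equiv.bijective _).comp ((Equiv.bijective _).comp (Equiv.bijective _))
  obtain ⟨v', hv', -, ⟨_⟩⟩ := hC.exists_dual hv
  have : IsIso (fromDual η v') :=
    isIso_of_bijective_compact hC.exists_generators _ fun c hc => by
      obtain ⟨c', -, ⟨_⟩, -⟩ := hC.exists_dual hc
      exact bijective_fromDual η hη v' c c'
  exact hv'.of_iso (asIso (fromDual η v'))

end LeftAdjoint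

section Powers

universe w

variable {A : Type w} [Category.{v} A] [MonoidalCategory A]

/-- The tensor powers of an object. -/
def tensorPow (a : A) : ℕ → A
  | 0 => 𝟙_ A
  | n + 1 => a ⊗ tensorPow a n

/-- The integral tensor powers of an object `a` with inverse `b`. -/
def tensorZPow (a b : A) : ℤ → A
  | Int.ofNat n => tensorPow a n
  | Int.negSucc n => tensorPow b (n + 1)

/-- Tensoring with `a ⊗ b ≅ 𝟙` is the identity. -/
def cancelInverse {a b : A} (e : a ⊗ b ≅ 𝟙_ A) (c : A) : c ≅ a ⊗ b ⊗ c :=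
  (λ_ c).symm ≪≫ whiskerRightIso e.symm c ≪≫ α_ a b c

lemma nonempty_tensorZPow_succ_iso {a b : A} (e : a ⊗ b ≅ 𝟙_ A) (n : ℤ) :
    Nonempty (tensorZPow a b (n + 1) ≅ a ⊗ tensorZPow a b n) :=
  match n with
  | Int.ofNat _ => ⟨Iso.refl _⟩
  | Int.negSucc 0 => ⟨cancelInverse e (𝟙_ A)⟩
  | Int.negSucc (k + 1) => ⟨cancelInverse e (tensorPow b (k + 1))⟩

lemma nonempty_tensorPow_iso_unit [BraidedCategory A] {a b : A} (e : a ⊗ b ≅ 𝟙_ A) (n : ℕ) :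
    Nonempty (tensorPow a n ⊗ tensorPow b n ≅ 𝟙_ A) := by
  induction n with
  | zero => exact ⟨λ_ (𝟙_ A)⟩
  | succ n ih =>
    obtain ⟨i⟩ := ih
    exact ⟨⟨tensorμ a (tensorPow a n) b (tensorPow b n), tensorδ a (tensorPow a n) b (tensorPow b n),
      tensorμ_tensorδ _ _ _ _, tensorδ_tensorμ _ _ _ _⟩ ≪≫ tensorIso e i ≪≫ λ_ (𝟙_ A)⟩

lemma nonempty_tensorZPow_neg_iso_unit [BraidedCategory A] {a b : A} (e : a ⊗ b ≅ 𝟙_ A) (n : ℤ) :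
    Nonempty (tensorZPow a b n ⊗ tensorZPow a b (-n) ≅ 𝟙_ A) :=
  match n with
  | Int.ofNat 0 => ⟨λ_ (𝟙_ A)⟩
  | Int.ofNat (k + 1) => nonempty_tensorPow_iso_unit e (k + 1)
  | Int.negSucc k => (nonempty_tensorPow_iso_unit e (k + 1)).map (β_ _ _ ≪≫ ·)

end Powers

section Tower

variable {D : Type u₁} {C : Type u₂} [Category.{v} D] [Category.{v} C]

/-- A doubly infinite tower of adjoints
`⋯ ⊣ f^(n) ⊣ f_(-n) ⊣ f^(n+1) ⊣ ⋯`. -/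
def IsAdjointTower (up : ℤ → (D ⥤ C)) (down : ℤ → (C ⥤ D)) : Prop :=
  ∀ n : ℤ, Nonempty (up n ⊣ down (-n)) ∧ Nonempty (down (-n) ⊣ up (n + 1))

variable {up up' : ℤ → (D ⥤ C)} {down down' : ℤ → (C ⥤ D)}

lemma IsAdjointTower.of_iso (h : IsAdjointTower up down) (eu : ∀ n, Nonempty (up n ≅ up' n))
    (ed : ∀ n, Nonempty (down n ≅ down' n)) : IsAdjointTower up' down' := by
  intro n
  obtain ⟨⟨a⟩, ⟨b⟩⟩ := h n
  obtain ⟨i⟩ := eu n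
  obtain ⟨j⟩ := ed (-n)
  obtain ⟨k⟩ := eu (n + 1)
  exact ⟨⟨(a.ofNatIsoLeft i).ofNatIsoRight j⟩, ⟨(b.ofNatIsoLeft j).ofNatIsoRight k⟩⟩

lemma IsAdjointTower.nonempty_up_iso (h : IsAdjointTower up down) (h' : IsAdjointTower up' down')
    (e : Nonempty (up 0 ≅ up' 0)) (n : ℤ) : Nonempty (up n ≅ up' n) := by
  induction n using Int.induction_on with
  | zero => exact e
  | succ i ih =>
    obtain ⟨⟨a⟩, ⟨b⟩⟩ := h i
    obtain ⟨⟨a'⟩, ⟨b'⟩⟩ := h' i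
    obtain ⟨k⟩ := ih
    exact ⟨(b.ofNatIsoLeft ((a.ofNatIsoLeft k).rightAdjointUniq a')).rightAdjointUniq b'⟩
  | pred i ih =>
    obtain ⟨⟨a⟩, ⟨b⟩⟩ := h (-i - 1)
    obtain ⟨⟨a'⟩, ⟨b'⟩⟩ := h' (-i - 1)
    rw [sub_add_cancel] at b b'
    obtain ⟨k⟩ := ih
    exact ⟨(a.ofNatIsoRight ((b.ofNatIsoRight k).leftAdjointUniq b')).leftAdjointUniq a'⟩

lemma IsAdjointTower.nonempty_down_iso (h : IsAdjointTower up down)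
    (h' : IsAdjointTower up' down') (e : Nonempty (up 0 ≅ up' 0)) (n : ℤ) :
    Nonempty (down n ≅ down' n) := by
  obtain ⟨⟨a⟩, -⟩ := h (-n)
  obtain ⟨⟨a'⟩, -⟩ := h' (-n)
  rw [neg_neg] at a a'
  obtain ⟨k⟩ := h.nonempty_up_iso h' e (-n)
  exact ⟨(a.ofNatIsoLeft k).rightAdjointUniq a'⟩

lemma IsAdjointTower.isRightAdjoint {f1 : C ⥤ D} (h : IsAdjointTower up down)
    (adjL : f1 ⊣ up 0) : f1.IsRightAdjoint := by
  obtain ⟨⟨a⟩, ⟨b⟩⟩ := h (-1)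
  rw [neg_add_cancel] at b
  exact (a.ofNatIsoRight (b.leftAdjointUniq adjL)).isRightAdjoint

lemma IsAdjointTower.isLeftAdjoint {fm1 : C ⥤ D} {fone : D ⥤ C}
    (h : IsAdjointTower up down) (adj2 : down 0 ⊣ fone) (adjR : fone ⊣ fm1) : fm1.IsLeftAdjoint := by
  obtain ⟨-, ⟨a⟩⟩ := h 0
  obtain ⟨⟨b⟩, ⟨c⟩⟩ := h 1
  rw [neg_zero, zero_add] at a
  exact (c.ofNatIsoLeft
    ((b.ofNatIsoLeft (a.rightAdjointUniq adj2)).rightAdjointUniq adjR)).isLeftAdjoint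

variable [MonoidalCategory C] [BraidedCategory C]
  {fstar : D ⥤ C} {fpush : C ⥤ D} {fone : D ⥤ C} {z w : C}

/-- If `f^(1) ≅ z ⊗ f^*` with `z` invertible, then the twists of `f^*` and `f_*` by the powers of
`z` form a tower of adjoints. -/
lemma isAdjointTower_twist (adj1 : fstar ⊣ fpush) (adj2 : fpush ⊣ fone)
    (γ : fstar ⋙ tensorLeft z ≅ fone) (e : z ⊗ w ≅ 𝟙_ C) :
    IsAdjointTower (fun n => fstar ⋙ tensorLeft (tensorZPow z w n))
      (fun n => tensorLeft (tensorZPow z w n) ⋙ fpush) := by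
  intro n
  obtain ⟨i⟩ := nonempty_tensorZPow_neg_iso_unit e n
  obtain ⟨j⟩ := nonempty_tensorZPow_succ_iso e n
  let k : fone ⋙ tensorLeft (tensorZPow z w n) ≅ fstar ⋙ tensorLeft (tensorZPow z w (n + 1)) :=
    Functor.isoWhiskerRight γ.symm _ ≪≫ Functor.associator _ _ _ ≪≫
      Functor.isoWhiskerLeft fstar ((tensorLeftTensor _ _).symm ≪≫
        tensorLeftIsoOfIso (β_ _ _ ≪≫ j.symm))
  exact ⟨⟨adj1.comp (tensorLeftAdjunctionOfIso i)⟩,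
    ⟨((tensorLeftAdjunctionOfIso (β_ _ _ ≪≫ i)).comp adj2).ofNatIsoRight k⟩⟩

/-- Tensoring with the unit is the identity. -/
def tensorLeftZPowZero (z w : C) : tensorLeft (tensorZPow z w 0) ≅ 𝟭 C :=
  leftUnitorNatIso C

lemma exists_isAdjointTower (adj1 : fstar ⊣ fpush) (adj2 : fpush ⊣ fone)
    (γ : fstar ⋙ tensorLeft z ≅ fone) (e : z ⊗ w ≅ 𝟙_ C) :
    ∃ (up : ℤ → (D ⥤ C)) (down : ℤ → (C ⥤ D)), up 0 = fstar ∧ down 0 = fpush ∧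
      IsAdjointTower up down := by
  refine ⟨fun n => if n = 0 then fstar else fstar ⋙ tensorLeft (tensorZPow z w n),
    fun n => if n = 0 then fpush else tensorLeft (tensorZPow z w n) ⋙ fpush, if_pos rfl,
    if_pos rfl, (isAdjointTower_twist adj1 adj2 γ e).of_iso (fun n => ?_) (fun n => ?_)⟩
  · by_cases hn : n = 0
    · subst hn
      exact ⟨Functor.isoWhiskerLeft fstar (tensorLeftZPowZero z w) ≪≫ fstar.rightUnitor⟩
    · rw [if_neg hn]
      exact ⟨Iso.refl _⟩
  · by_cases hn : n = 0
    · subst hn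
      exact ⟨Functor.isoWhiskerRight (tensorLeftZPowZero z w) fpush ≪≫ fpush.leftUnitor⟩
    · rw [if_neg hn]
      exact ⟨Iso.refl _⟩

end Tower

/-- The Wirthmüller isomorphism, Theorem 1.7. -/
theorem statement9 {D : Type u₁} {C : Type u₂}
    [Category.{v} D] [Preadditive D] [HasZeroObject D] [HasShift D ℤ]
    [∀ n : ℤ, (shiftFunctor D n).Additive] [Pretriangulated D] [IsTriangulated D]
    [MonoidalCategory D] [SymmetricCategory D] [MonoidalClosed D]
    [Category.{v} C] [Preadditive C] [HasZeroObject C] [HasShift C ℤ]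
    [∀ n : ℤ, (shiftFunctor C n).Additive] [Pretriangulated C] [IsTriangulated C]
    [MonoidalCategory C] [SymmetricCategory C] [MonoidalClosed C]
    (fstar : D ⥤ C) [fstar.Braided] [fstar.CommShift ℤ] [fstar.IsTriangulated]
    (hD : RigidlyCompactlyGenerated D) (hC : RigidlyCompactlyGenerated C)
    (hcop : PreservesCoproducts fstar)
    (f1 : C ⥤ D) (adjL : f1 ⊣ fstar)
    (fpush : C ⥤ D) (adj1 : fstar ⊣ fpush)
    (fone : D ⥤ C) (adj2 : fpush ⊣ fone)
    (fm1 : C ⥤ D) (adjR : fone ⊣ fm1) :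
    List.TFAE [
      -- (W1)
      f1.IsRightAdjoint,
      -- (W2)
      fm1.IsLeftAdjoint,
      -- (W3)
      IsCompactObj (fone.obj (𝟙_ D)),
      -- (W4)
      TensorInvertible (fone.obj (𝟙_ D)),
      -- (W5)
      ∃ u : C, TensorInvertible u ∧ Nonempty ((tensorLeft u ⋙ fpush) ⊣ fstar),
      -- (W6)
      ∃ (up : ℤ → (D ⥤ C)) (down : ℤ → (C ⥤ D)), up 0 = fstar ∧ down 0 = fpush ∧
        ∀ n : ℤ, Nonempty (up n ⊣ down (-n)) ∧ Nonempty (down (-n) ⊣ up (n + 1))] ∧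
    -- moreover, any such tower is given by twisting with powers of ω
    (IsCompactObj (fone.obj (𝟙_ D)) →
      ∀ (up : ℤ → (D ⥤ C)) (down : ℤ → (C ⥤ D)), up 0 = fstar → down 0 = fpush →
        (∀ n : ℤ, Nonempty (up n ⊣ down (-n)) ∧ Nonempty (down (-n) ⊣ up (n + 1))) →
        ∃ P : ℤ → C, Nonempty (P 0 ≅ 𝟙_ C) ∧
          (∀ n : ℤ, Nonempty (P (n + 1) ≅ fone.obj (𝟙_ D) ⊗ P n)) ∧
          (∀ n : ℤ, Nonempty (up n ≅ fstar ⋙ tensorLeft (P n)) ∧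
            Nonempty (down n ≅ tensorLeft (P n) ⋙ fpush))) := by
  obtain ⟨γ⟩ := nonempty_tensorLeft_fone_iso hD adj1 adj2 adjR
  obtain ⟨θ⟩ := nonempty_push_dualizing_iso hD hC adjL adj1 adj2 adjR
  refine ⟨?_, fun hω up down hu hd h => ?_⟩
  · tfae_have 1 → 3 := fun _ => isCompactObj_of_adjunction_push hD hC adj1 adj2
      ((Adjunction.ofIsRightAdjoint f1).ofNatIsoRight θ.symm)
    tfae_have 2 → 3 := fun _ => hD.isCompactObj_unit.map adjR
      (preservesCoproducts_of_adjunction (Adjunction.ofIsLeftAdjoint fm1))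
    tfae_have 3 → 4 := tensorInvertible_dualizing hD hC adj1 adj2 adjR
    tfae_have 4 → 3 := hC.isCompactObj_of_tensorInvertible
    tfae_have 4 → 5 := fun h => ⟨_, h, ⟨adjL.ofNatIsoLeft θ.symm⟩⟩
    tfae_have 5 → 4 := by
      rintro ⟨u, ⟨u', ⟨e⟩⟩, ⟨adj⟩⟩
      let i := adj.rightAdjointUniq ((tensorLeftAdjunctionOfIso e).comp adj2)
      exact ⟨u', ⟨β_ _ _ ≪≫ (i.app (𝟙_ D)).symm ≪≫ (Functor.Monoidal.εIso fstar).symm⟩⟩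
    tfae_have 4 → 6 := fun ⟨_, ⟨e⟩⟩ => exists_isAdjointTower adj1 adj2 γ e
    tfae_have 6 → 1 := by
      rintro ⟨up, down, rfl, -, h⟩
      exact IsAdjointTower.isRightAdjoint h adjL
    tfae_have 6 → 2 := by
      rintro ⟨up, down, -, rfl, h⟩
      exact IsAdjointTower.isLeftAdjoint h adj2 adjR
    tfae_finish
  · obtain ⟨w, ⟨e⟩⟩ := tensorInvertible_dualizing hD hC adj1 adj2 adjR hω
    have h' := isAdjointTower_twist adj1 adj2 γ e
    have h₀ : Nonempty (up 0 ≅ fstar ⋙ tensorLeft (tensorZPow (fone.obj (𝟙_ D)) w 0)) :=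
      ⟨eqToIso hu ≪≫ fstar.rightUnitor.symm ≪≫
        Functor.isoWhiskerLeft fstar (tensorLeftZPowZero _ w).symm⟩
    exact ⟨tensorZPow (fone.obj (𝟙_ D)) w, ⟨Iso.refl _⟩, nonempty_tensorZPow_succ_iso e,
      fun n => ⟨IsAdjointTower.nonempty_up_iso h h' h₀ n,
        IsAdjointTower.nonempty_down_iso h h' h₀ n⟩⟩

end GN
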